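/- Let V be a VLSM with a sent oracle: a predicate sent(s,m) on states of V such that for every constrained state s of V, sent(s,m) holds iff m is emitted on every constrained trace of V reaching s. Define sent^e(γ, m) = ∃ k ≤ len(γ), sent(γ[k], m) on states of the equivocating VLSM V^e. Then sent^e is a sent oracle for V^e: for every constrained state γ of V^e and every message m, sent^e(γ, m) holds iff m is emitted on every constrained trace of V^e reaching γ. -/

import Mathlib

set_option autoImplicit false

universe u v w

/-- A validating labelled state transition and message production system (VLSM):
labels, a nonempty set of initial states, initial messages, a total transition
function and a validity constraint.  `Option M` plays the role of `M ∪ {⊥}`. -/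
structure VLSM (L : Type u) (S : Type v) (M : Type w) where
  init : Set S
  init_ne : init.Nonempty
  initMsg : Set M
  tau : L → S → Option M → S × Option M
  beta : L → S → Option M → Prop

/-- A transition record: label, source state, input message, target state, output message. -/
structure VTrans (L : Type u) (S : Type v) (M : Type w) where
  lbl : L
  src : S
  msg : Option M
  dst : S
  out : Option M

variable {L : Type u} {S : Type v} {M : Type w}

/-- `Chain s tr sf`: the transitions of `tr` link up, starting at `s` and ending at `sf`. -/
def Chain : S → List (VTrans L S M) → S → Prop
  | s, [], sf => s = sf
  | s, t :: ts, sf => t.src = s ∧ Chain t.dst ts sf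

namespace VLSM

/-- `t` is an actual transition of `V` (the transition function agrees with `t`). -/
def IsTrans (V : VLSM L S M) (t : VTrans L S M) : Prop :=
  V.tau t.lbl t.src t.msg = (t.dst, t.out)

/-- `t` is a constrained transition of `V`. -/
def IsConstrainedTrans (V : VLSM L S M) (t : VTrans L S M) : Prop :=
  V.IsTrans t ∧ V.beta t.lbl t.src t.msg

/-- `tr` is a constrained trace of `V` reaching the state `sf`. -/
def ConstrainedTraceTo (V : VLSM L S M) (tr : List (VTrans L S M)) (sf : S) : Prop :=
  (∀ t ∈ tr, V.IsConstrainedTrans t) ∧ ∃ s0 ∈ V.init, Chain s0 tr sf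

/-- A state is constrained if some constrained trace reaches it. -/
def ConstrainedState (V : VLSM L S M) (s : S) : Prop :=
  ∃ tr, V.ConstrainedTraceTo tr s

/-- Constrained reachability, defined inductively (a state is constrained iff it is
reachable from an initial state by constrained transitions). -/
inductive ReachState (V : VLSM L S M) : S → Prop where
  | init {s} : s ∈ V.init → ReachState V s
  | step {l s m} : ReachState V s → V.beta l s m → ReachState V (V.tau l s m).1

mutual
  /-- Valid states of a VLSM. -/
  inductive ValidState (V : VLSM L S M) : S → Prop where
    | init {s} : s ∈ V.init → ValidState V s
    | step {l s m} : ValidState V s → ValidOMsg V m → V.beta l s m →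
        ValidState V (V.tau l s m).1
  /-- Valid optional messages of a VLSM (`none` is always valid). -/
  inductive ValidOMsg (V : VLSM L S M) : Option M → Prop where
    | none : ValidOMsg V Option.none
    | init {m} : m ∈ V.initMsg → ValidOMsg V (some m)
    | step {l s m} : ValidState V s → ValidOMsg V m → V.beta l s m →
        ValidOMsg V (V.tau l s m).2
end

/-- `t` is a valid transition of `V`. -/
def IsValidTrans (V : VLSM L S M) (t : VTrans L S M) : Prop :=
  V.IsConstrainedTrans t ∧ V.ValidState t.src ∧ V.ValidOMsg t.msg

/-- `tr` is a valid trace of `V` reaching the state `sf`. -/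
def ValidTraceTo (V : VLSM L S M) (tr : List (VTrans L S M)) (sf : S) : Prop :=
  (∀ t ∈ tr, V.IsValidTrans t) ∧ ∃ s0 ∈ V.init, Chain s0 tr sf

/-- `tr` is a valid trace of `V`. -/
def IsValidTrace (V : VLSM L S M) (tr : List (VTrans L S M)) : Prop :=
  ∃ sf, V.ValidTraceTo tr sf

end VLSM

/-- The message `m` is emitted (sent) on the trace `tr`. -/
def EmittedOn (tr : List (VTrans L S M)) (m : M) : Prop := ∃ t ∈ tr, t.out = some m

/-- The message `m` is received on the trace `tr`. -/
def ReceivedOn (tr : List (VTrans L S M)) (m : M) : Prop := ∃ t ∈ tr, t.msg = some m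

/-- `sent` is a sent-oracle for `V`: at every constrained state `s`, `sent s m` holds
iff `m` is emitted on every constrained trace reaching `s`. -/
def IsSentOracle (V : VLSM L S M) (sent : S → M → Prop) : Prop :=
  ∀ s, V.ConstrainedState s → ∀ m,
    (sent s m ↔ ∀ tr, V.ConstrainedTraceTo tr s → EmittedOn tr m)

/-- `recv` is a received-oracle for `V`. -/
def IsReceivedOracle (V : VLSM L S M) (recv : S → M → Prop) : Prop :=
  ∀ s, V.ConstrainedState s → ∀ m,
    (recv s m ↔ ∀ tr, V.ConstrainedTraceTo tr s → ReceivedOn tr m)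

/-- The full node assumption: whenever receiving `m` is allowed by the validity
constraint, every direct dependency of `m` has been directly observed in the state. -/
def FullNodeAssumption (V : VLSM L S M) (dep : M → M → Prop)
    (sent recv : S → M → Prop) : Prop :=
  ∀ l s m, V.beta l s (some m) → ∀ m', dep m' m → sent s m' ∨ recv s m'

section Composition

variable {ι : Type*} [DecidableEq ι] {Lf : ι → Type*} {Sf : ι → Type*}

/-- The constrained composition of an indexed family of VLSMs over the same
message set, under the composition constraint `φ`. -/
noncomputable def comp (V : ∀ i, VLSM (Lf i) (Sf i) M)
    (φ : (Σ i, Lf i) → (∀ i, Sf i) → Option M → Prop) :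
    VLSM (Σ i, Lf i) (∀ i, Sf i) M where
  init := {σ | ∀ i, σ i ∈ (V i).init}
  init_ne := ⟨fun i => ((V i).init_ne).choose, fun i => ((V i).init_ne).choose_spec⟩
  initMsg := ⋃ i, (V i).initMsg
  tau := fun l σ m =>
    (Function.update σ l.1 ((V l.1).tau l.2 (σ l.1) m).1, ((V l.1).tau l.2 (σ l.1) m).2)
  beta := fun l σ m => (V l.1).beta l.2 (σ l.1) m ∧ φ l σ m

/-- The free composition of an indexed family of VLSMs over the same message set. -/
noncomputable def freeComp (V : ∀ i, VLSM (Lf i) (Sf i) M) :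
    VLSM (Σ i, Lf i) (∀ i, Sf i) M :=
  comp V fun _ _ _ => True

/-- Component `j` is a validator for the composite VLSM `W`: every constrained
transition from a constrained state of `V j` lifts to a valid transition of `W`
with matching `j`-th state components and matching input/output messages. -/
def IsValidatorAt (V : ∀ i, VLSM (Lf i) (Sf i) M)
    (W : VLSM (Σ i, Lf i) (∀ i, Sf i) M) (j : ι) : Prop :=
  ∀ l s m, (V j).ConstrainedState s → (V j).beta l s m →
    ∃ σ : ∀ i, Sf i, σ j = s ∧
      W.IsValidTrans ⟨⟨j, l⟩, σ, m, (W.tau ⟨j, l⟩ σ m).1, (W.tau ⟨j, l⟩ σ m).2⟩ ∧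
      (W.tau ⟨j, l⟩ σ m).1 j = ((V j).tau l s m).1 ∧
      (W.tau ⟨j, l⟩ σ m).2 = ((V j).tau l s m).2

/-- The induced `j`-th projection of a composite VLSM `W`: the same VLSM as the
component `Vj`, except that its initial messages are all valid messages of `W`. -/
def projV {L' : Type*} {S' : Type*} {L2 : Type*} {S2 : Type*}
    (Vj : VLSM L' S' M) (W : VLSM L2 S2 M) : VLSM L' S' M :=
  { Vj with initMsg := {m | W.ValidOMsg (some m)} }

/-- The projection of a composite trace on component `j`. -/
def projTrace (j : ι) (tr : List (VTrans (Σ i, Lf i) (∀ i, Sf i) M)) :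
    List (VTrans (Lf j) (Sf j) M) :=
  tr.filterMap fun t =>
    if h : t.lbl.1 = j then some ⟨h ▸ t.lbl.2, t.src j, t.msg, t.dst j, t.out⟩ else none

/-- The composition constraint of the fixed-set message-equivocation model:
the only message-equivocations allowed are among the components of `E`. -/
def phiM (sender : M → ι) (sent : ∀ i, Sf i → M → Prop) (E : Set ι) :
    (Σ i, Lf i) → (∀ i, Sf i) → Option M → Prop :=
  fun l σ m => ∀ mm, m = some mm →
    (sent (sender mm) (σ (sender mm)) mm ∨ (l.1 ∈ E ∧ sender mm ∈ E))

end Composition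

/-- Labels of the equivocating VLSM associated to a VLSM: act as the `i`-th copy,
duplicate the `i`-th copy, or spawn a new machine after position `i` (1-based). -/
inductive ELabel (L : Type u) (S : Type v) where
  | act (i : ℕ) (l : L)
  | dup (i : ℕ)
  | new (i : ℕ) (s : S)

/-- The equivocating VLSM associated to a VLSM `V`: its states are (nonempty) lists
of states of `V`, and it can fork itself or spawn fresh copies at any moment. -/
noncomputable def eVLSM (V : VLSM L S M) : VLSM (ELabel L S) (List S) M where
  init := {γ | ∃ s ∈ V.init, γ = [s]}
  init_ne := ⟨[V.init_ne.choose], V.init_ne.choose, V.init_ne.choose_spec, rfl⟩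
  initMsg := V.initMsg
  tau := fun lab γ m =>
    match lab with
    | .act i l =>
      match γ[i - 1]? with
      | some s => (γ.set (i - 1) (V.tau l s m).1, (V.tau l s m).2)
      | none => (γ, Option.none)
    | .dup i =>
      match γ[i - 1]? with
      | some s => (γ.take i ++ s :: γ.drop i, Option.none)
      | none => (γ, Option.none)
    | .new i s0 => (γ.take i ++ s0 :: γ.drop i, Option.none)
  beta := fun lab γ m =>
    match lab with
    | .act i l => 1 ≤ i ∧ i ≤ γ.length ∧ ∃ s, γ[i - 1]? = some s ∧ V.beta l s m
    | .dup i => 1 ≤ i ∧ i ≤ γ.length ∧ m = Option.none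
    | .new i s0 => 1 ≤ i ∧ i ≤ γ.length ∧ m = Option.none ∧ s0 ∈ V.init

theorem chain_append {s sf : S} {tr tr' : List (VTrans L S M)} :
    Chain s (tr ++ tr') sf ↔ ∃ u, Chain s tr u ∧ Chain u tr' sf := by
  induction tr generalizing s with
  | nil => simp [Chain]
  | cons t ts ih => simp [Chain, ih, and_assoc]

theorem EmittedOn.append_iff {tr tr' : List (VTrans L S M)} {m : M} :
    EmittedOn (tr ++ tr') m ↔ EmittedOn tr m ∨ EmittedOn tr' m := by
  simp only [EmittedOn, List.mem_append, or_and_right, exists_or]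

namespace VLSM

theorem constrainedTraceTo_nil {V : VLSM L S M} {s : S} :
    V.ConstrainedTraceTo [] s ↔ s ∈ V.init := by
  simp [ConstrainedTraceTo, Chain]

theorem constrainedTraceTo_append {V : VLSM L S M} {tr tr' : List (VTrans L S M)} {sf : S} :
    V.ConstrainedTraceTo (tr ++ tr') sf ↔
      ∃ s, V.ConstrainedTraceTo tr s ∧ (∀ t ∈ tr', V.IsConstrainedTrans t) ∧ Chain s tr' sf := by
  simp only [ConstrainedTraceTo, chain_append, List.forall_mem_append]
  grind

theorem constrainedTraceTo_concat {V : VLSM L S M} {tr : List (VTrans L S M)}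
    {t : VTrans L S M} {sf : S} :
    V.ConstrainedTraceTo (tr ++ [t]) sf ↔
      V.ConstrainedTraceTo tr t.src ∧ V.IsConstrainedTrans t ∧ t.dst = sf := by
  simp only [constrainedTraceTo_append, List.forall_mem_singleton, Chain]
  grind

end VLSM

/-- Every machine in the target of a constrained transition of `eVLSM V` is already in the
source, is initial, or results from a constrained transition of `V` with the same output. -/
theorem eVLSM_mem_dst {V : VLSM L S M} {t : VTrans (ELabel L S) (List S) M}
    (ht : (eVLSM V).IsConstrainedTrans t) {s : S} (hs : s ∈ t.dst) :
    s ∈ t.src ∨ s ∈ V.init ∨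
      ∃ l, ∃ s' ∈ t.src, V.IsConstrainedTrans ⟨l, s', t.msg, s, t.out⟩ := by
  obtain ⟨lbl, src, msg, dst, out⟩ := t
  obtain ⟨htau, hbeta⟩ := ht
  cases lbl with
  | act i l =>
    obtain ⟨-, -, s', hs', hb⟩ := hbeta
    simp only [VLSM.IsTrans, eVLSM, hs', Prod.mk.injEq] at htau
    obtain ⟨rfl, rfl⟩ := htau
    rcases List.mem_or_eq_of_mem_set hs with h | rfl
    · exact .inl h
    · exact .inr (.inr ⟨l, s', List.mem_of_getElem? hs', rfl, hb⟩)
  | dup i =>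
    left
    simp only [VLSM.IsTrans, eVLSM] at htau
    grind [List.mem_of_mem_take, List.mem_of_mem_drop]
  | new i s0 =>
    obtain ⟨-, -, -, hinit⟩ := hbeta
    simp only [VLSM.IsTrans, eVLSM] at htau
    grind [List.mem_of_mem_take, List.mem_of_mem_drop]

theorem eVLSM_dst_ne_nil {V : VLSM L S M} {t : VTrans (ELabel L S) (List S) M}
    (ht : (eVLSM V).IsConstrainedTrans t) : t.dst ≠ [] := by
  obtain ⟨lbl, src, msg, dst, out⟩ := t
  obtain ⟨htau, hbeta⟩ := ht
  rw [← List.length_pos_iff]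
  cases lbl <;> simp only [VLSM.IsTrans, eVLSM] at htau hbeta <;> grind

theorem eVLSM_constrainedState_ne_nil {V : VLSM L S M} {γ : List S}
    (hγ : (eVLSM V).ConstrainedState γ) : γ ≠ [] := by
  obtain ⟨tr, htr⟩ := hγ
  rcases List.eq_nil_or_concat' tr with rfl | ⟨tr, t, rfl⟩
  · obtain ⟨s, -, rfl⟩ := VLSM.constrainedTraceTo_nil.mp htr
    simp
  · obtain ⟨-, ht, rfl⟩ := VLSM.constrainedTraceTo_concat.mp htr
    exact eVLSM_dst_ne_nil ht

/-- A constrained trace of `eVLSM V` projects to a constrained trace of `V` reaching any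
chosen machine of its final state, emitting no additional messages. -/
theorem eVLSM_exists_projection {V : VLSM L S M} {tr : List (VTrans (ELabel L S) (List S) M)}
    {γ : List S} (htr : (eVLSM V).ConstrainedTraceTo tr γ) {s : S} (hs : s ∈ γ) :
    ∃ tr', V.ConstrainedTraceTo tr' s ∧ ∀ m, EmittedOn tr' m → EmittedOn tr m := by
  induction tr using List.reverseRecOn generalizing γ s with
  | nil =>
    obtain ⟨s0, h0, rfl⟩ := VLSM.constrainedTraceTo_nil.mp htr
    obtain rfl := List.mem_singleton.mp hs
    exact ⟨[], VLSM.constrainedTraceTo_nil.mpr h0, by simp [EmittedOn]⟩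
  | append_singleton tr t ih =>
    obtain ⟨hsrc, ht, rfl⟩ := VLSM.constrainedTraceTo_concat.mp htr
    rcases eVLSM_mem_dst ht hs with h | h | ⟨l, s', hs', h⟩
    · obtain ⟨tr', htr', hm⟩ := ih hsrc h
      exact ⟨tr', htr', fun m h => EmittedOn.append_iff.mpr (.inl (hm m h))⟩
    · exact ⟨[], VLSM.constrainedTraceTo_nil.mpr h, by simp [EmittedOn]⟩
    · obtain ⟨tr', htr', hm⟩ := ih hsrc hs'
      refine ⟨tr' ++ [_], VLSM.constrainedTraceTo_concat.mpr ⟨htr', h, rfl⟩, fun m h => ?_⟩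
      rw [EmittedOn.append_iff] at h ⊢
      exact h.imp (hm m) (by simp [EmittedOn])

/-- The transition of `eVLSM V` performing `t` on the machine placed after the machines `γ`. -/
def VTrans.liftLast (γ : List S) (t : VTrans L S M) : VTrans (ELabel L S) (List S) M :=
  ⟨.act (γ.length + 1) t.lbl, γ ++ [t.src], t.msg, γ ++ [t.dst], t.out⟩

theorem VTrans.isConstrainedTrans_liftLast {V : VLSM L S M} (γ : List S) {t : VTrans L S M}
    (ht : V.IsConstrainedTrans t) : (eVLSM V).IsConstrainedTrans (t.liftLast γ) := by
  obtain ⟨htau, hbeta⟩ := ht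
  unfold VLSM.IsTrans at htau
  constructor
  · simp [VLSM.IsTrans, eVLSM, VTrans.liftLast, htau]
  · simpa [eVLSM, VTrans.liftLast] using hbeta

theorem chain_map_liftLast (γ : List S) {tr : List (VTrans L S M)} {s sf : S}
    (h : Chain s tr sf) : Chain (γ ++ [s]) (tr.map (VTrans.liftLast γ)) (γ ++ [sf]) := by
  induction tr generalizing s with
  | nil => simpa [Chain] using h
  | cons t ts ih =>
    obtain ⟨rfl, h⟩ := h
    exact ⟨rfl, ih h⟩

theorem emittedOn_map_liftLast {γ : List S} {tr : List (VTrans L S M)} {m : M} :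
    EmittedOn (tr.map (VTrans.liftLast γ)) m ↔ EmittedOn tr m := by
  simp [EmittedOn, VTrans.liftLast]

/-- If every machine of `γ` is reachable in `V` without emitting `m`, then `γ` is reachable in
`eVLSM V` without emitting `m`. -/
theorem eVLSM_exists_trace_not_emittedOn {V : VLSM L S M} {m : M} {γ : List S} (hne : γ ≠ [])
    (hγ : ∀ s ∈ γ, ∃ tr, V.ConstrainedTraceTo tr s ∧ ¬ EmittedOn tr m) :
    ∃ tr, (eVLSM V).ConstrainedTraceTo tr γ ∧ ¬ EmittedOn tr m := by
  induction γ using List.reverseRecOn with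
  | nil => exact absurd rfl hne
  | append_singleton γ s ih =>
    obtain ⟨trs, ⟨htrs, s0, hs0, hchain⟩, hm⟩ := hγ s (by simp)
    have hlift : ∀ t ∈ trs.map (VTrans.liftLast γ), (eVLSM V).IsConstrainedTrans t := by
      simpa using fun t ht => VTrans.isConstrainedTrans_liftLast γ (htrs t ht)
    rcases eq_or_ne γ [] with rfl | hγne
    · exact ⟨trs.map (VTrans.liftLast []),
        ⟨hlift, [s0], ⟨s0, hs0, rfl⟩, chain_map_liftLast [] hchain⟩,
        emittedOn_map_liftLast.not.mpr hm⟩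
    · obtain ⟨tr, htr, hm'⟩ := ih hγne fun s hs => hγ s (by simp [hs])
      let spawn : VTrans (ELabel L S) (List S) M :=
        ⟨.new γ.length s0, γ, none, γ ++ [s0], none⟩
      have hspawn : (eVLSM V).IsConstrainedTrans spawn := by
        refine ⟨by simp [VLSM.IsTrans, eVLSM, spawn], ?_⟩
        exact ⟨List.length_pos_of_ne_nil hγne, le_rfl, rfl, hs0⟩
      refine ⟨(tr ++ [spawn]) ++ trs.map (VTrans.liftLast γ),
        VLSM.constrainedTraceTo_append.mpr ⟨γ ++ [s0],
          VLSM.constrainedTraceTo_concat.mpr ⟨htr, hspawn, rfl⟩, hlift,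
          chain_map_liftLast γ hchain⟩, ?_⟩
      rw [EmittedOn.append_iff, EmittedOn.append_iff, emittedOn_map_liftLast]
      have hs : ¬ EmittedOn [spawn] m := by simp [EmittedOn, spawn]
      tauto

/-- If `sent` is a sent oracle for `V`, then its lift
`sent^e(γ, m) = ∃ k ≤ len(γ), sent(γ[k], m)` is a sent oracle for the
equivocating VLSM `V^e`. -/
theorem equivocator_HasBeenSentCapability {L S M : Type}
    (V : VLSM L S M) (sent : S → M → Prop) (hsent : IsSentOracle V sent) :
    IsSentOracle (eVLSM V) (fun γ m => ∃ s ∈ γ, sent s m) := by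
  intro γ hγ m
  have hreach : ∀ s ∈ γ, V.ConstrainedState s := fun s hs => by
    obtain ⟨tr, htr⟩ := hγ
    obtain ⟨tr', htr', -⟩ := eVLSM_exists_projection htr hs
    exact ⟨tr', htr'⟩
  constructor
  · rintro ⟨s, hs, hsm⟩ tr htr
    obtain ⟨tr', htr', hm⟩ := eVLSM_exists_projection htr hs
    exact hm m ((hsent s (hreach s hs) m).mp hsm tr' htr')
  · intro h
    by_contra! hno
    obtain ⟨tr, htr, hm⟩ := eVLSM_exists_trace_not_emittedOn (m := m)
      (eVLSM_constrainedState_ne_nil hγ) fun s hs => by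
        simpa [hsent s (hreach s hs) m] using hno s hs
    exact hm (h tr htr)
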